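/- Let L be a linear classifier on {0,1}^d given by weights w and threshold t, let x ∈ {0,1}^d, and define feature scores s_i = w_i·(2x_i − 1)·(2L(x) − 1). Let y ⊆ x be a partial instance with coordinate i defined (y_i ≠ ⊥) and s_i ≤ 0, and let y ⊖ i be y with coordinate i set to undefined. Then Pr_{z ∈ comp(y ⊖ i)}[L(z) = L(x)] ≥ Pr_{z ∈ comp(y)}[L(z) = L(x)] under the uniform distribution over completions. -/

import Mathlib

/-- Output of the linear classifier with weights `w` and threshold `t` on `z ∈ {0,1}^d`. -/
def linOut {d : ℕ} (w : Fin d → ℚ) (t : ℚ) (z : Fin d → Bool) : Bool :=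
  decide (t ≤ ∑ i, w i * (if z i then 1 else 0))

/-- Completions of a partial instance `y ∈ {0,1,⊥}^d`. -/
def completions {d : ℕ} (y : Fin d → Option Bool) : Finset (Fin d → Bool) :=
  Finset.univ.filter (fun z => ∀ i, ∀ b, y i = some b → z i = b)

/-- `Pr_{z ~ U(y)}[L(z) = L(x)]`, uniform over the completions of `y`. -/
def prSame {d : ℕ} (w : Fin d → ℚ) (t : ℚ) (x : Fin d → Bool)
    (y : Fin d → Option Bool) : ℚ :=
  (((completions y).filter (fun z => linOut w t z = linOut w t x)).card : ℚ)
    / ((completions y).card : ℚ)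

/-- Score of feature `i`: `w_i (2x_i - 1)(2L(x) - 1)`. -/
def score {d : ℕ} (w : Fin d → ℚ) (t : ℚ) (x : Fin d → Bool) (i : Fin d) : ℚ :=
  w i * (2 * (if x i then 1 else 0) - 1) * (2 * (if linOut w t x then 1 else 0) - 1)

/-- `y ⊆ x`: the partial instance `y` agrees with `x` on its defined coordinates. -/
def subsetOf {d : ℕ} (y : Fin d → Option Bool) (x : Fin d → Bool) : Prop :=
  ∀ i, ∀ b, y i = some b → x i = b

/-- `z` with its `i`-th coordinate negated. -/
def flipAt {d : ℕ} (i : Fin d) (z : Fin d → Bool) : Fin d → Bool :=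
  Function.update z i (!z i)

@[simp]
theorem flipAt_apply_self {d : ℕ} (i : Fin d) (z : Fin d → Bool) : flipAt i z i = !z i := by
  simp [flipAt]

theorem flipAt_apply_of_ne {d : ℕ} {i j : Fin d} (h : j ≠ i) (z : Fin d → Bool) :
    flipAt i z j = z j := by
  simp [flipAt, h]

theorem flipAt_involutive {d : ℕ} (i : Fin d) : Function.Involutive (flipAt i) := by
  intro z
  simp [flipAt]

theorem sum_mul_flipAt {d : ℕ} (w : Fin d → ℚ) (i : Fin d) (z : Fin d → Bool) :
    ∑ j, w j * (if flipAt i z j then 1 else 0) =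
      ∑ j, w j * (if z j then 1 else 0) - w i * (2 * (if z i then 1 else 0) - 1) := by
  rw [← Finset.add_sum_erase _ _ (Finset.mem_univ i),
    ← Finset.add_sum_erase _ (fun j => w j * (if z j then (1 : ℚ) else 0)) (Finset.mem_univ i),
    Finset.sum_congr rfl fun j hj => by rw [flipAt_apply_of_ne (Finset.ne_of_mem_erase hj)]]
  cases h : z i <;> simp only [flipAt_apply_self, h, Bool.not_true, Bool.not_false, if_true,
    Bool.false_eq_true, if_false] <;> ring

theorem mem_completions {d : ℕ} {y : Fin d → Option Bool} {z : Fin d → Bool} :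
    z ∈ completions y ↔ ∀ i, ∀ b, y i = some b → z i = b := by
  simp [completions]

theorem completions_update_none {d : ℕ} {y : Fin d → Option Bool} {i : Fin d} {b : Bool}
    (hb : y i = some b) :
    completions (Function.update y i none) =
      completions y ∪ (completions y).image (flipAt i) := by
  ext z
  simp only [Finset.mem_union, Finset.mem_image,
    mem_completions]
  constructor
  · intro h
    have h' : ∀ j, j ≠ i → ∀ c, y j = some c → z j = c := fun j hj c hc =>
      h j c (by rw [Function.update_of_ne hj, hc])
    by_cases hz : z i = b
    · left
      intro j c hc
      by_cases hj : j = i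
      · subst hj
        simp_all
      · exact h' j hj c hc
    · refine Or.inr ⟨flipAt i z, fun j c hc => ?_, flipAt_involutive i z⟩
      by_cases hj : j = i
      · subst hj
        rw [flipAt_apply_self]
        cases c <;> simp_all
      · rw [flipAt_apply_of_ne hj, h' j hj c hc]
  · rintro (h | ⟨u, h, rfl⟩) j c hc <;> by_cases hj : j = i
    · simp [hj] at hc
    · rw [Function.update_of_ne hj] at hc
      exact h j c hc
    · simp [hj] at hc
    · rw [Function.update_of_ne hj] at hc
      rw [flipAt_apply_of_ne hj, h j c hc]

theorem disjoint_completions_image_flipAt {d : ℕ} {y : Fin d → Option Bool} {i : Fin d} {b : Bool}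
    (hb : y i = some b) :
    Disjoint (completions y) ((completions y).image (flipAt i)) := by
  rw [Finset.disjoint_left]
  intro z hz hz'
  obtain ⟨u, hu, rfl⟩ := Finset.mem_image.1 hz'
  have h₁ := mem_completions.1 hz i b hb
  have h₂ := mem_completions.1 hu i b hb
  simp [h₂] at h₁

/-- Flipping a feature of nonpositive score, where `z` agrees with `x`, preserves `L(z) = L(x)`. -/
theorem linOut_flipAt_eq {d : ℕ} {w : Fin d → ℚ} {t : ℚ} {x z : Fin d → Bool} {i : Fin d}
    (hs : score w t x i ≤ 0) (hzi : z i = x i) (hz : linOut w t z = linOut w t x) :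
    linOut w t (flipAt i z) = linOut w t x := by
  unfold score at hs
  rw [← hzi] at hs
  rw [← hz] at hs ⊢
  have hsum := sum_mul_flipAt w i z
  cases h : linOut w t z <;> simp only [h] at hs
  · simp only [linOut, decide_eq_false_iff_not, not_le] at h ⊢
    simp only [Bool.false_eq_true, if_false] at hs
    linarith
  · simp only [linOut, decide_eq_true_eq] at h ⊢
    simp only [if_true] at hs
    linarith

theorem remove_nonpos_score_feature (d : ℕ) (hd : 1 ≤ d) (w : Fin d → ℚ) (t : ℚ)
    (x : Fin d → Bool) (y : Fin d → Option Bool) (hy : subsetOf y x)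
    (i : Fin d) (hi : (y i).isSome) (hs : score w t x i ≤ 0) :
    prSame w t x y ≤ prSame w t x (Function.update y i none) := by
  obtain ⟨b, hb⟩ := Option.isSome_iff_exists.1 hi
  have hinj := (flipAt_involutive i).injective
  have hdisj := disjoint_completions_image_flipAt hb
  have hcard : (completions (Function.update y i none)).card = 2 * (completions y).card := by
    rw [completions_update_none hb, Finset.card_union_of_disjoint hdisj,
      Finset.card_image_of_injective _ hinj, two_mul]
  have hsame : 2 * ((completions y).filter (fun z => linOut w t z = linOut w t x)).card ≤
      ((completions (Function.update y i none)).filter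
        (fun z => linOut w t z = linOut w t x)).card := by
    rw [completions_update_none hb, Finset.filter_union,
      Finset.card_union_of_disjoint (Finset.disjoint_filter_filter hdisj), two_mul]
    refine Nat.add_le_add_left ?_ _
    rw [← Finset.card_image_of_injective _ hinj]
    refine Finset.card_le_card (Finset.image_subset_iff.2 fun z hz => ?_)
    obtain ⟨hzy, hzL⟩ := Finset.mem_filter.1 hz
    have hzi : z i = x i := (mem_completions.1 hzy i b hb).trans (hy i b hb).symm
    exact Finset.mem_filter.2 ⟨Finset.mem_image_of_mem _ hzy, linOut_flipAt_eq hs hzi hzL⟩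
  unfold prSame
  rw [hcard, Nat.cast_mul, ← mul_div_mul_left _ _ (two_ne_zero (α := ℚ)), Nat.cast_ofNat]
  gcongr
  exact_mod_cast hsame
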